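/- arXiv:2303.01797 — 13 statements merged into one kernel-verified Lean document; each statement's English description precedes it below -/
import Mathlib

section
/- Let D be a convex subset of a normed space X, let f : D → ℝ be a continuous convex function, let x ∈ D, and let x* ∈ ∂f(x). Then x is an x*-small diameter point for f if and only if the point (x, f(x)) is a strongly exposed point of the epigraph epi(f) ⊆ X × ℝ exposed by the functional (x*, −1). -/
open Filter

/-- The epigraph of `f` over `D`, as a subset of `X × ℝ`. -/
def Epigraph {X : Type*} [NormedAddCommGroup X] [NormedSpace ℝ X]
    (D : Set X) (f : X → ℝ) : Set (X × ℝ) :=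
  {p : X × ℝ | p.1 ∈ D ∧ f p.1 ≤ p.2}

/-- If every sequence of `D` along which `g` tends to `g x` converges, then every such sequence
converges to `x`. -/
theorem tendsto_of_forall_exists_tendsto {X : Type*} [TopologicalSpace X] [T2Space X]
    {D : Set X} {g : X → ℝ} {x : X} (hx : x ∈ D)
    (h : ∀ u : ℕ → X, (∀ n, u n ∈ D) → Tendsto (fun n => g (u n)) atTop (nhds (g x)) →
      ∃ l, Tendsto u atTop (nhds l))
    {u : ℕ → X} (hu : ∀ n, u n ∈ D) (hg : Tendsto (fun n => g (u n)) atTop (nhds (g x))) :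
    Tendsto u atTop (nhds x) := by
  have hhalf : Tendsto (fun n : ℕ => n / 2) atTop atTop :=
    Nat.tendsto_div_const_atTop two_ne_zero
  have heven : Tendsto (fun n : ℕ => 2 * n) atTop atTop :=
    tendsto_atTop_mono (fun n => show n ≤ _ by omega) tendsto_id
  have hodd : Tendsto (fun n : ℕ => 2 * n + 1) atTop atTop :=
    tendsto_atTop_mono (fun n => show n ≤ _ by omega) tendsto_id
  obtain ⟨l, hl⟩ := h (fun n => if Even n then u (n / 2) else x)
    (fun n => by split_ifs <;> simp [hu, hx])
    (by
      simp only [apply_ite g]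
      exact (hg.comp hhalf).if' tendsto_const_nhds)
  have hul : Tendsto u atTop (nhds l) := by simpa [Function.comp_def] using hl.comp heven
  have hxl : Tendsto (fun _ : ℕ => x) atTop (nhds l) := by
    simpa [Function.comp_def] using hl.comp hodd
  rwa [tendsto_nhds_unique tendsto_const_nhds hxl]

/-- Let `D` be a convex subset of a normed space `X`, `f : D → ℝ`
continuous and convex, `x ∈ D`, and `x* ∈ ∂f(x)`. Then `x` is an `x*`-small diameter
point for `f` if and only if `(x, f x)` is a strongly exposed point of the epigraph
`epi(f) ⊆ X × ℝ`, exposed by the functional `(x*, -1)`. -/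
theorem smallDiamPoint_iff_stronglyExposed_epigraph
    {X : Type*} [NormedAddCommGroup X] [NormedSpace ℝ X]
    (D : Set X) (hD : Convex ℝ D) (f : X → ℝ)
    (hconv : ConvexOn ℝ D f) (hcont : ContinuousOn f D)
    (x : X) (hx : x ∈ D) (xs : X →L[ℝ] ℝ)
    (hsub : ∀ y ∈ D, xs y - xs x ≤ f y - f x) :
    -- `x` is an `x*`-small diameter point for `f`:
    (∀ u : ℕ → X, (∀ n, u n ∈ D) →
        Tendsto (fun n => xs (u n) - f (u n)) atTop (nhds (xs x - f x)) →
        ∃ l, Tendsto u atTop (nhds l)) ↔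
      -- `(x, f x)` is strongly exposed in `epi f` by `(x*, -1)`; note that the
      -- functional `(x*, -1)` acts on `X × ℝ` by `p ↦ xs p.1 - p.2`, and its
      -- supremum over the epigraph is attained at `(x, f x)`:
      ((∀ p ∈ Epigraph D f, xs p.1 - p.2 ≤ xs x - f x) ∧
        ∀ v : ℕ → X × ℝ, (∀ n, v n ∈ Epigraph D f) →
          Tendsto (fun n => xs (v n).1 - (v n).2) atTop (nhds (xs x - f x)) →
          Tendsto v atTop (nhds (x, f x))) := by
  constructor
  · intro h
    have hle : ∀ p ∈ Epigraph D f, xs p.1 - p.2 ≤ xs x - f x := fun p hp => by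
      linarith [hsub p.1 hp.1, hp.2]
    refine ⟨hle, fun v hv hlim => ?_⟩
    have hfst : Tendsto (fun n => (v n).1) atTop (nhds x) := by
      refine tendsto_of_forall_exists_tendsto (g := fun y => xs y - f y) hx h
        (fun n => (hv n).1) ?_
      exact tendsto_of_tendsto_of_tendsto_of_le_of_le hlim tendsto_const_nhds
        (fun n => sub_le_sub_left (hv n).2 _)
        (fun n => hle ((v n).1, f (v n).1) ⟨(hv n).1, le_rfl⟩)
    have hsnd : Tendsto (fun n => (v n).2) atTop (nhds (f x)) := by
      simpa using ((xs.continuous.tendsto x).comp hfst).sub hlim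
    exact hfst.prodMk_nhds hsnd
  · rintro ⟨-, h⟩ u hu hlim
    exact ⟨x, (continuous_fst.tendsto _).comp
      (h (fun n => (u n, f (u n))) (fun n => ⟨hu n, le_rfl⟩) hlim)⟩
end

section
/- Let X be a normed space and let f, g : X → ℝ be convex continuous functions. If f has the small diameter property, then f + g has the small diameter property. -/
open Filter

/-- `xs` belongs to the subdifferential of `f : X → ℝ` at `x`. -/
def Subdiff {X : Type*} [NormedAddCommGroup X] [NormedSpace ℝ X]
    (f : X → ℝ) (x : X) (xs : X →L[ℝ] ℝ) : Prop :=
  ∀ y, xs y - xs x ≤ f y - f x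

/-- `x` is an `xs`-small diameter point for `f : X → ℝ`: every sequence `{xₙ}`
with `xs xₙ - f xₙ → xs x - f x` is norm convergent. -/
def SmallDiamPt {X : Type*} [NormedAddCommGroup X] [NormedSpace ℝ X]
    (f : X → ℝ) (x : X) (xs : X →L[ℝ] ℝ) : Prop :=
  ∀ u : ℕ → X,
    Tendsto (fun n => xs (u n) - f (u n)) atTop (nhds (xs x - f x)) →
    ∃ l, Tendsto u atTop (nhds l)

/-- `f` has the small diameter property (SDP). -/
def HasSDP {X : Type*} [NormedAddCommGroup X] [NormedSpace ℝ X]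
    (f : X → ℝ) : Prop :=
  ∀ (x : X) (xs : X →L[ℝ] ℝ), Subdiff f x xs → SmallDiamPt f x xs

/-- Sum rule: a subgradient of `f + g` splits into a subgradient of `f` and one of `g`. -/
theorem Subdiff.exists_subdiff_sub {X : Type*} [NormedAddCommGroup X] [NormedSpace ℝ X]
    {f g : X → ℝ} (hf : ConvexOn ℝ Set.univ f) (hfc : Continuous f)
    (hg : ConvexOn ℝ Set.univ g) {x : X} {xs : X →L[ℝ] ℝ} (h : Subdiff (f + g) x xs) :
    ∃ a : X →L[ℝ] ℝ, Subdiff f x a ∧ Subdiff g x (xs - a) := by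
  have hS : Convex ℝ {p : X × ℝ | f p.1 < p.2} := by
    simpa using hf.convex_strict_epigraph
  have hT : Convex ℝ {p : X × ℝ | p.2 ≤ xs p.1 - g p.1 - (xs x - g x - f x)} := by
    have hc : ConcaveOn ℝ Set.univ fun y => xs y - g y - (xs x - g x - f x) :=
      ((xs.toLinearMap.concaveOn convex_univ).sub hg).sub
        (convexOn_const (xs x - g x - f x) convex_univ)
    simpa using hc.convex_hypograph
  have hSo : IsOpen {p : X × ℝ | f p.1 < p.2} :=
    isOpen_lt (hfc.comp continuous_fst) continuous_snd
  have hd : Disjoint {p : X × ℝ | f p.1 < p.2}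
      {p : X × ℝ | p.2 ≤ xs p.1 - g p.1 - (xs x - g x - f x)} := by
    rw [Set.disjoint_left]
    intro p hp hq
    have := h p.1
    simp only [Pi.add_apply, Set.mem_ofPred_eq] at this hp hq
    linarith
  obtain ⟨φ, u, hφS, hφT⟩ := geometric_hahn_banach_open hS hSo hT hd
  set p : X →L[ℝ] ℝ := φ.comp (ContinuousLinearMap.inl ℝ X ℝ)
  set c : ℝ := φ (0, 1)
  have hφ (y : X) (t : ℝ) : φ (y, t) = p y + t * c := by
    have hyt : ((y, t) : X × ℝ) = (y, 0) + t • ((0, 1) : X × ℝ) := by simp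
    rw [hyt, map_add, map_smul, smul_eq_mul]
    rfl
  have hlow (y : X) : u ≤ p y + (xs y - g y - (xs x - g x - f x)) * c := by
    rw [← hφ]
    exact hφT (y, _) (le_refl (xs y - g y - (xs x - g x - f x)))
  have hup (y : X) (t : ℝ) (ht : f y < t) : p y + t * c < u := by
    rw [← hφ]
    exact hφS _ ht
  have hup' (y : X) : p y + f y * c ≤ u := by
    have hlim : Tendsto (fun t => p y + t * c) (nhdsWithin (f y) (Set.Ioi (f y)))
        (nhds (p y + f y * c)) :=
      (Continuous.tendsto (by fun_prop) (f y)).mono_left nhdsWithin_le_nhds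
    refine le_of_tendsto hlim ?_
    filter_upwards [self_mem_nhdsWithin] with t ht using (hup y t ht).le
  have hx := hlow x
  have hc : c < 0 := by linarith [hup x (f x + 1) (by linarith)]
  have hp (y : X) : p y = (-c⁻¹ • p) y * -c := by
    simp [mul_right_comm _ (p y), hc.ne]
  refine ⟨-c⁻¹ • p, fun y => ?_, fun y => ?_⟩
  · have := hup' y
    rw [hp] at this hx
    refine le_of_mul_le_mul_right ?_ (neg_pos.2 hc)
    linarith
  · have h1 := hlow y
    have h2 := hup' x
    rw [hp] at h1 h2
    refine le_of_mul_le_mul_right ?_ (neg_pos.2 hc)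
    simp only [sub_apply]
    linarith

/-- If `f, g : X → ℝ` are convex continuous functions and `f` has
the small diameter property, then `f + g` has the small diameter property. -/
theorem hasSDP_add {X : Type*} [NormedAddCommGroup X] [NormedSpace ℝ X]
    (f g : X → ℝ)
    (hf : ConvexOn ℝ Set.univ f) (hfc : Continuous f)
    (hg : ConvexOn ℝ Set.univ g) (hgc : Continuous g)
    (hSDP : HasSDP f) :
    HasSDP (f + g) := by
  intro x xs h u hu
  obtain ⟨a, ha, hb⟩ := h.exists_subdiff_sub hf hfc hg
  refine hSDP x a ha u ?_
  have hlow : Tendsto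
      (fun n => xs (u n) - (f + g) (u n) - ((xs - a) x - g x)) atTop (nhds (a x - f x)) := by
    convert hu.sub_const ((xs - a) x - g x) using 2
    simp only [Pi.add_apply, sub_apply]
    ring
  refine tendsto_of_tendsto_of_tendsto_of_le_of_le hlow tendsto_const_nhds
    (fun n => ?_) (fun n => ?_)
  · have := hb (u n)
    simp only [Pi.add_apply, sub_apply] at this ⊢
    linarith
  · have := ha (u n)
    dsimp only
    linarith
end

section
/- Let (X, ‖·‖) be a normed space, let x₀ ∈ S_X be a point of the unit sphere such that x₀, as a point of the closed unit ball B_X, is strongly exposed by some x* ∈ S_{X*}. Let h : [0,∞) → ℝ be a continuous, convex, strictly increasing function, let λ > 0 and λ* ∈ ℝ, and suppose λ is a λ*-small diameter point for h. Then the function x ↦ h(‖x‖) is continuous and convex on X, and λx₀ is a (λ*x*)-small diameter point for the function x ↦ h(‖x‖). -/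
open Filter Set

/-- A norm-one functional attaining its supremum over the unit ball at `x₀` takes the value `1`
there. -/
theorem apply_eq_one_of_le_on_closedBall
    {X : Type*} [NormedAddCommGroup X] [NormedSpace ℝ X]
    {x₀ : X} (hx₀ : ‖x₀‖ = 1) {xs : X →L[ℝ] ℝ} (hxs : ‖xs‖ = 1)
    (hsupp : ∀ y ∈ Metric.closedBall (0 : X) 1, xs y ≤ xs x₀) : xs x₀ = 1 := by
  apply le_antisymm
  · simpa [hxs, hx₀] using (le_abs_self _).trans (xs.le_opNorm x₀)
  · rw [← hxs]
    have h0 : 0 ≤ xs x₀ := by simpa using hsupp 0 (by simp)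
    refine xs.opNorm_le_of_unit_norm h0 fun y hy => abs_le.2 ⟨?_, hsupp y (by simp [hy])⟩
    have := hsupp (-y) (by simp [hy])
    rw [map_neg] at this
    linarith

/-- A sequence alternating between two distinct reals diverges. -/
theorem eq_of_tendsto_ite_even {a b c : ℝ}
    (hc : Tendsto (fun n : ℕ => if Even n then a else b) atTop (nhds c)) : a = b := by
  have ha := hc.comp (tendsto_atTop_mono (fun n : ℕ => show n ≤ 2 * n by lia) tendsto_id)
  have hb := hc.comp (tendsto_atTop_mono (fun n : ℕ => show n ≤ 2 * n + 1 by lia) tendsto_id)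
  have ha' : Tendsto (fun _ : ℕ => a) atTop (nhds c) := ha.congr fun n => by simp
  have hb' : Tendsto (fun _ : ℕ => b) atTop (nhds c) := hb.congr fun n => by simp
  rw [tendsto_nhds_unique tendsto_const_nhds ha', tendsto_nhds_unique tendsto_const_nhds hb']

/-- Let `x₀ ∈ S_X` be strongly exposed, as a point of `B_X`, by a
norm-one functional `x*`. Let `h : [0,∞) → ℝ` be continuous, convex and strictly
increasing, and let `λ > 0` be a `λ*`-small diameter point for `h`. Then
`x ↦ h ‖x‖` is continuous and convex on `X`, and `λ • x₀` is a `(λ* • x*)`-small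
diameter point for `x ↦ h ‖x‖`. -/
theorem liftStronglyExposed_smallDiamPoint
    {X : Type*} [NormedAddCommGroup X] [NormedSpace ℝ X]
    (x₀ : X) (hx₀ : ‖x₀‖ = 1)
    (xs : X →L[ℝ] ℝ) (hxs : ‖xs‖ = 1)
    -- `x₀ ∈ B_X` is strongly exposed by `xs`:
    (hsupp : ∀ y ∈ Metric.closedBall (0 : X) 1, xs y ≤ xs x₀)
    (hse : ∀ u : ℕ → X, (∀ n, u n ∈ Metric.closedBall (0 : X) 1) →
      Tendsto (fun n => xs (u n)) atTop (nhds (xs x₀)) →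
      Tendsto u atTop (nhds x₀))
    -- `h : [0,∞) → ℝ` continuous, convex, strictly increasing:
    (h : ℝ → ℝ) (hhc : ContinuousOn h (Ici 0)) (hhconv : ConvexOn ℝ (Ici 0) h)
    (hhmono : StrictMonoOn h (Ici 0))
    (lam lamstar : ℝ) (hlam : 0 < lam)
    -- `λ*` belongs to the subdifferential of `h` at `λ` (on `[0,∞)`):
    (hlsub : ∀ y ∈ Ici (0 : ℝ), lamstar * y - lamstar * lam ≤ h y - h lam)
    -- `λ` is a `λ*`-small diameter point for `h`:
    (hlsdp : ∀ u : ℕ → ℝ, (∀ n, u n ∈ Ici (0 : ℝ)) →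
      Tendsto (fun n => lamstar * u n - h (u n)) atTop (nhds (lamstar * lam - h lam)) →
      ∃ c, Tendsto u atTop (nhds c)) :
    -- (i) `x ↦ h ‖x‖` is continuous and convex on `X`;
    Continuous (fun x : X => h ‖x‖) ∧
    ConvexOn ℝ Set.univ (fun x : X => h ‖x‖) ∧
    -- (ii) `λ • x₀` is a `(λ* • x*)`-small diameter point for `x ↦ h ‖x‖`:
    (∀ y : X, (lamstar • xs) y - (lamstar • xs) (lam • x₀) ≤ h ‖y‖ - h ‖lam • x₀‖) ∧
    (∀ u : ℕ → X,
      Tendsto (fun n => (lamstar • xs) (u n) - h ‖u n‖) atTop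
        (nhds ((lamstar • xs) (lam • x₀) - h ‖lam • x₀‖)) →
      ∃ l, Tendsto u atTop (nhds l)) := by
  have hone : xs x₀ = 1 := apply_eq_one_of_le_on_closedBall hx₀ hxs hsupp
  have hle : ∀ y, xs y ≤ ‖y‖ := fun y => by
    simpa [hxs] using (le_abs_self _).trans (xs.le_opNorm y)
  have hpos : 0 < lamstar := by
    have h1 := hlsub 0 self_mem_Ici
    have h2 := hhmono self_mem_Ici (mem_Ici.2 hlam.le) hlam
    by_contra! hneg
    nlinarith
  have hnorm : ‖lam • x₀‖ = lam := by rw [norm_smul, hx₀, mul_one, Real.norm_of_nonneg hlam.le]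
  have hval : (lamstar • xs) (lam • x₀) = lamstar * lam := by simp [hone, mul_comm]
  have hcont : Continuous (fun x : X => h ‖x‖) :=
    hhc.comp_continuous continuous_norm fun x => norm_nonneg x
  refine ⟨hcont, ⟨convex_univ, fun x _ y _ a b ha hb hab => ?_⟩, fun y => ?_, fun u hu => ?_⟩
  · have hmem : a • ‖x‖ + b • ‖y‖ ∈ Ici (0 : ℝ) :=
      (convex_Ici 0) (norm_nonneg x) (norm_nonneg y) ha hb hab
    refine (hhmono.monotoneOn (norm_nonneg _) hmem ?_).trans
      (hhconv.2 (norm_nonneg x) (norm_nonneg y) ha hb hab)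
    refine (norm_add_le _ _).trans_eq ?_
    simp [norm_smul, abs_of_nonneg, ha, hb]
  · rw [hval, hnorm]
    refine le_trans ?_ (hlsub ‖y‖ (norm_nonneg y))
    simpa using mul_le_mul_of_nonneg_left (hle y) hpos.le
  · rw [hval, hnorm] at hu
    have hv : Tendsto (fun n => lamstar * ‖u n‖ - h ‖u n‖) atTop
        (nhds (lamstar * lam - h lam)) := by
      refine tendsto_of_tendsto_of_tendsto_of_le_of_le hu tendsto_const_nhds (fun n => ?_)
        fun n => ?_
      · simpa using mul_le_mul_of_nonneg_left (hle (u n)) hpos.le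
      · have := hlsub ‖u n‖ (norm_nonneg _)
        show lamstar * ‖u n‖ - h ‖u n‖ ≤ lamstar * lam - h lam
        linarith
    obtain ⟨c, hc⟩ := hlsdp _ (fun n => norm_nonneg (u n)) hv
    have hc0 : 0 ≤ c := ge_of_tendsto' hc fun n => norm_nonneg _
    have hhc' : Tendsto (fun n => h ‖u n‖) atTop (nhds (h c)) :=
      (hhc c hc0).tendsto.comp
        (tendsto_nhdsWithin_iff.2 ⟨hc, Eventually.of_forall fun n => norm_nonneg _⟩)
    have hceq : lamstar * c - h c = lamstar * lam - h lam :=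
      tendsto_nhds_unique ((hc.const_mul lamstar).sub hhc') hv
    obtain ⟨d, hd⟩ := hlsdp (fun n => if Even n then c else lam)
      (fun n => by split_ifs <;> simp [hc0, hlam.le])
      (tendsto_const_nhds.congr fun n => by split_ifs <;> simp [hceq])
    obtain rfl : c = lam := eq_of_tendsto_ite_even hd
    have hxsu : Tendsto (fun n => xs (u n)) atTop (nhds c) := by
      have := (hu.add hhc').const_mul lamstar⁻¹
      rw [sub_add_cancel, inv_mul_cancel_left₀ hpos.ne'] at this
      refine this.congr fun n => ?_
      simp [hpos.ne']
    have hw : Tendsto (fun n => ‖u n‖⁻¹ • u n) atTop (nhds x₀) := by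
      refine hse _ (fun n => ?_) ?_
      · rw [mem_closedBall_zero_iff, norm_smul, norm_inv, norm_norm]
        exact inv_mul_le_one
      · have := (hc.inv₀ hlam.ne').mul hxsu
        rw [inv_mul_cancel₀ hlam.ne', ← hone] at this
        simpa using this
    refine ⟨c • x₀, (hc.smul hw).congr fun n => ?_⟩
    by_cases hn : u n = 0
    · simp [hn]
    · rw [smul_inv_smul₀ (norm_ne_zero_iff.2 hn)]
end

section
/- Let X be a normed space and let f : X → ℝ be a convex continuous function. If f is uniformly convex at x for every x ∈ X, then f has the small diameter property. -/
open Filter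

/-- `f` is uniformly convex at `x₀`. -/
def UniformlyConvexAt {X : Type*} [NormedAddCommGroup X] [NormedSpace ℝ X]
    (f : X → ℝ) (x₀ : X) : Prop :=
  ∀ ε > (0 : ℝ), ∃ δ > (0 : ℝ), ∀ y : X, ε ≤ ‖x₀ - y‖ →
    f ((1 / 2 : ℝ) • (x₀ + y)) ≤ (1 / 2) * f x₀ + (1 / 2) * f y - δ

/-- If a convex continuous function `f : X → ℝ` is uniformly
convex at every point `x ∈ X`, then `f` has the small diameter property. -/
theorem hasSDP_of_uniformlyConvexAt
    {X : Type*} [NormedAddCommGroup X] [NormedSpace ℝ X]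
    (f : X → ℝ) (hconv : ConvexOn ℝ Set.univ f) (hcont : Continuous f)
    (huc : ∀ x : X, UniformlyConvexAt f x) :
    HasSDP f := by
  intro x xs hxs u hu
  refine ⟨x, Metric.tendsto_atTop'.mpr fun ε hε => ?_⟩
  obtain ⟨δ, hδ, h⟩ := huc x ε hε
  obtain ⟨N, hN⟩ := eventually_atTop.mp
    (hu.eventually_const_lt (show xs x - f x - 2 * δ < xs x - f x by linarith))
  refine ⟨N, fun n hn => ?_⟩
  by_contra! hfar
  rw [dist_comm, dist_eq_norm] at hfar
  have hmid := hxs ((1 / 2 : ℝ) • (x + u n))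
  rw [map_smul, map_add, smul_eq_mul] at hmid
  linarith [h (u n) hfar, hN n hn.le]
end

section
/- Let X be a normed space and let f : X → ℝ be a convex continuous function. If f has the small diameter property, then f is strictly convex. -/
open Filter

/-- A continuous convex function on a normed space has a subgradient at every point. -/
theorem exists_subdiff_of_convexOn_of_continuous
    {X : Type*} [NormedAddCommGroup X] [NormedSpace ℝ X]
    {f : X → ℝ} (hconv : ConvexOn ℝ Set.univ f) (hcont : Continuous f) (x : X) :
    ∃ xs : X →L[ℝ] ℝ, Subdiff f x xs := by
  have hconvex : Convex ℝ {p : X × ℝ | f p.1 < p.2} := by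
    simpa using hconv.convex_strict_epigraph
  have hopen : IsOpen {p : X × ℝ | f p.1 < p.2} :=
    isOpen_lt (hcont.comp continuous_fst) continuous_snd
  obtain ⟨F, hF⟩ := geometric_hahn_banach_point_open hconvex hopen
    (x := (x, f x)) (by simp)
  have hsplit (y : X) (t : ℝ) : F (y, t) = F (y, 0) + t * F (0, 1) := by
    have h : ((y, t) : X × ℝ) = (y, 0) + t • (0, 1) := by simp
    rw [h, map_add, map_smul, smul_eq_mul]
  have hpos : 0 < F (0, 1) := by
    have h := hF (x, f x + 1) (by simp)
    rw [hsplit x (f x), hsplit x (f x + 1)] at h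
    linarith
  refine ⟨-(F (0, 1))⁻¹ • F.comp (ContinuousLinearMap.inl ℝ X ℝ), fun y => ?_⟩
  refine le_of_forall_pos_lt_add fun ε hε => ?_
  have h := hF (y, f y + ε) (by simpa using hε)
  rw [hsplit x (f x), hsplit y (f y + ε)] at h
  simp only [smul_apply, ContinuousLinearMap.comp_apply,
    ContinuousLinearMap.inl_apply, smul_eq_mul]
  calc
    -(F (0, 1))⁻¹ * F (y, 0) - -(F (0, 1))⁻¹ * F (x, 0)
        = (F (x, 0) - F (y, 0)) / F (0, 1) := by ring
    _ < f y - f x + ε := by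
      rw [div_lt_iff₀ hpos]
      linarith

/-- At a small diameter point, `xs - f` takes its value at that point nowhere else. -/
theorem SmallDiamPt.eq_of_apply_sub_eq
    {X : Type*} [NormedAddCommGroup X] [NormedSpace ℝ X]
    {f : X → ℝ} {x y : X} {xs : X →L[ℝ] ℝ} (h : SmallDiamPt f x xs)
    (hy : xs y - f y = xs x - f x) : y = x := by
  obtain ⟨l, hl⟩ := h (fun n => if Even n then y else x) <| by
    refine tendsto_const_nhds.congr fun n => ?_
    split_ifs
    · exact hy.symm
    · rfl
  have heven : Tendsto (fun n : ℕ => 2 * n) atTop atTop :=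
    strictMono_mul_left_of_pos two_pos |>.tendsto_atTop
  have hodd : Tendsto (fun n : ℕ => 2 * n + 1) atTop atTop :=
    (tendsto_add_atTop_nat 1).comp heven
  have hly : y = l := tendsto_nhds_unique tendsto_const_nhds
    ((hl.comp heven).congr fun n => by simp)
  have hlx : x = l := tendsto_nhds_unique tendsto_const_nhds
    ((hl.comp hodd).congr fun n => by simp)
  exact hly.trans hlx.symm

/-- If a convex continuous function `f : X → ℝ` has the small
diameter property, then `f` is strictly convex: for every pair of distinct points
`x, y` one has `f((x+y)/2) < (f x + f y)/2`. -/
theorem strictConvex_of_hasSDP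
    {X : Type*} [NormedAddCommGroup X] [NormedSpace ℝ X]
    (f : X → ℝ) (hconv : ConvexOn ℝ Set.univ f) (hcont : Continuous f)
    (hSDP : HasSDP f) :
    ∀ x y : X, x ≠ y → f ((1 / 2 : ℝ) • (x + y)) < (f x + f y) / 2 := by
  intro x y hxy
  by_contra! hle
  obtain ⟨xs, hxs⟩ :=
    exists_subdiff_of_convexOn_of_continuous hconv hcont ((1 / 2 : ℝ) • (x + y))
  have hm : xs ((1 / 2 : ℝ) • (x + y)) = (xs x + xs y) / 2 := by
    rw [map_smul, map_add, smul_eq_mul]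
    ring
  have hx := hxs x
  have hy := hxs y
  have hpt := hSDP _ xs hxs
  exact hxy <| (hpt.eq_of_apply_sub_eq (by linarith)).trans
    (hpt.eq_of_apply_sub_eq (by linarith)).symm
end

section
/- Let K be a compact convex subset of a normed space X and let f : K → ℝ be a continuous strictly convex function. Then f is uniformly convex on K. -/
/-- Let `K` be a compact convex subset of a normed space `X` and
let `f : K → ℝ` be continuous and strictly convex. Then `f` is uniformly convex
on `K`: for every `ε > 0` there exists `δ > 0` such that for all `x, y ∈ K` with
`‖x - y‖ ≥ ε` one has `f ((x+y)/2) ≤ f x / 2 + f y / 2 - δ`. -/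
theorem uniformlyConvexOn_of_strictConvexOn_compact
    {X : Type*} [NormedAddCommGroup X] [NormedSpace ℝ X]
    (K : Set X) (hKc : IsCompact K) (hKconv : Convex ℝ K)
    (f : X → ℝ) (hcont : ContinuousOn f K)
    (hstrict : ∀ x ∈ K, ∀ y ∈ K, x ≠ y →
      f ((1 / 2 : ℝ) • (x + y)) < (f x + f y) / 2) :
    ∀ ε > (0 : ℝ), ∃ δ > (0 : ℝ), ∀ x ∈ K, ∀ y ∈ K, ε ≤ ‖x - y‖ →
      f ((1 / 2 : ℝ) • (x + y)) ≤ (1 / 2) * f x + (1 / 2) * f y - δ := by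
  intro ε hε
  let S : Set (X × X) := (K ×ˢ K) ∩ {p | ε ≤ ‖p.1 - p.2‖}
  have hS : IsCompact S :=
    (hKc.prod hKc).inter_right (isClosed_le continuous_const (by fun_prop))
  have hmid : ContinuousOn (fun p : X × X => f ((1 / 2 : ℝ) • (p.1 + p.2))) S := by
    refine hcont.comp (by fun_prop) fun p hp => ?_
    rw [smul_add]
    exact hKconv hp.1.1 hp.1.2 (by norm_num) (by norm_num) (by norm_num)
  have hfst : ContinuousOn (fun p : X × X => f p.1) S :=
    hcont.comp continuousOn_fst fun p hp => hp.1.1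
  have hsnd : ContinuousOn (fun p : X × X => f p.2) S :=
    hcont.comp continuousOn_snd fun p hp => hp.1.2
  have hgap : ContinuousOn
      (fun p : X × X => (f p.1 + f p.2) / 2 - f ((1 / 2 : ℝ) • (p.1 + p.2))) S :=
    ((hfst.add hsnd).div_const 2).sub hmid
  obtain ⟨δ, hδ, hδS⟩ := hS.exists_forall_le' hgap (a := 0) fun p hp => by
    refine sub_pos.2 (hstrict _ hp.1.1 _ hp.1.2 fun h => ?_)
    have hle : ε ≤ ‖p.1 - p.2‖ := hp.2
    rw [h, sub_self, norm_zero] at hle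
    exact hle.not_gt hε
  refine ⟨δ, hδ, fun x hx y hy hxy => ?_⟩
  have hle := hδS (x, y) ⟨⟨hx, hy⟩, hxy⟩
  dsimp only at hle
  linarith
end

section
/- Let X be a normed space and let f₁, …, f_N : X → ℝ be strictly convex functions. Then every weak Pareto Optimum point for f₁, …, f_N is a Pareto Optimum point for f₁, …, f_N. -/
/-- `x₀` is a Pareto Optimum point for the family `f`. -/
def IsParetoOptimum {X : Type*} [NormedAddCommGroup X] [NormedSpace ℝ X]
    {N : ℕ} (f : Fin N → X → ℝ) (x₀ : X) : Prop :=
  ¬ ∃ x : X, (∀ k, f k x ≤ f k x₀) ∧ ∃ i, f i x < f i x₀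

/-- `x₀` is a weak Pareto Optimum point for the family `f`. -/
def IsWeakParetoOptimum {X : Type*} [NormedAddCommGroup X] [NormedSpace ℝ X]
    {N : ℕ} (f : Fin N → X → ℝ) (x₀ : X) : Prop :=
  ¬ ∃ x : X, ∀ k, f k x < f k x₀

/-- If `f₁, …, f_N : X → ℝ` are strictly convex, then every weak
Pareto Optimum point for `f₁, …, f_N` is a Pareto Optimum point. -/
theorem isParetoOptimum_of_isWeakParetoOptimum
    {X : Type*} [NormedAddCommGroup X] [NormedSpace ℝ X]
    {N : ℕ} (f : Fin N → X → ℝ)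
    (hstrict : ∀ i, ∀ x y : X, x ≠ y →
      f i ((1 / 2 : ℝ) • (x + y)) < (f i x + f i y) / 2)
    (x₀ : X) (hx₀ : IsWeakParetoOptimum f x₀) :
    IsParetoOptimum f x₀ := by
  rintro ⟨x, hle, i, hi⟩
  have hne : x ≠ x₀ := by
    rintro rfl
    exact lt_irrefl _ hi
  exact hx₀ ⟨(1 / 2 : ℝ) • (x + x₀), fun k => by
    linarith [hstrict k x x₀ hne, hle k]⟩
end

section
/- Let X be a normed space and let f₁, …, f_N : X → ℝ be convex functions. If x₀ ∈ X is a weak Pareto Optimum point for f₁, …, f_N, then there exists t = (t₁, …, t_N) ∈ Σ_N such that u_t(x₀) ≤ u_t(x) for every x ∈ X, where u_t = ∑_{i=1}^N t_i f_i. -/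
/-- A convex family of functions that is never simultaneously negative has a nontrivial
nonnegative combination that is nonnegative everywhere. -/
theorem exists_nonneg_weights_of_not_all_neg {ι X : Type*} [Fintype ι] [AddCommGroup X]
    [Module ℝ X] {g : ι → X → ℝ} (hg : ∀ i, ConvexOn ℝ Set.univ (g i))
    (hneg : ¬ ∃ x, ∀ i, g i x < 0) :
    ∃ c : ι → ℝ, (∀ i, 0 ≤ c i) ∧ 0 < ∑ i, c i ∧ ∀ x, 0 ≤ ∑ i, c i * g i x := by
  classical
  let S : Set (ι → ℝ) := {y | ∃ x, ∀ i, g i x < y i}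
  have hopen : IsOpen S := by
    have hS : S = ⋃ x, Set.univ.pi fun i => Set.Ioi (g i x) := by
      ext y
      simp [S]
    rw [hS]
    exact isOpen_iUnion fun x => isOpen_set_pi Set.finite_univ fun i _ => isOpen_Ioi
  have hconvex : Convex ℝ S := by
    rintro y ⟨x, hx⟩ z ⟨w, hw⟩ a b ha hb hab
    refine ⟨a • x + b • w, fun i => ((hg i).2 trivial trivial ha hb hab).trans_lt ?_⟩
    simp only [Pi.add_apply, Pi.smul_apply, smul_eq_mul]
    rcases ha.eq_or_lt with rfl | ha'
    · obtain rfl : b = 1 := by linarith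
      simpa using hw i
    · exact add_lt_add_of_lt_of_le (mul_lt_mul_of_pos_left (hx i) ha')
        (mul_le_mul_of_nonneg_left (hw i).le hb)
  obtain ⟨φ, hφ⟩ := geometric_hahn_banach_point_open (x := 0) hconvex hopen hneg
  let c : ι → ℝ := fun i => φ fun j => if i = j then 1 else 0
  have hφc (y : ι → ℝ) : φ y = ∑ i, c i * y i := by
    simpa [c, mul_comm] using φ.toLinearMap.pi_apply_eq_sum_univ y
  have hpos (y : ι → ℝ) (x : X) (hxy : ∀ i, g i x < y i) : 0 < ∑ i, c i * y i := by
    simpa [hφc] using hφ y ⟨x, hxy⟩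
  have hshift (x : X) (ε : ℝ) (hε : 0 < ε) : 0 < ∑ i, c i * g i x + ε * ∑ i, c i := by
    have h := hpos (fun i => g i x + ε) x fun i => by linarith
    simpa [mul_add, Finset.sum_add_distrib, ← Finset.sum_mul, mul_comm ε] using h
  have hnonneg (i : ι) : 0 ≤ c i := by
    by_contra! hi
    have hM (M : ℝ) (hM : 0 ≤ M) : 0 < ∑ j, c j * (g j 0 + 1) + c i * M := by
      have h := hpos (fun j => g j 0 + 1 + Pi.single (M := fun _ => ℝ) i M j) 0 fun j => by
        have : 0 ≤ Pi.single (M := fun _ => ℝ) i M j := by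
          rw [Pi.single_apply]
          split_ifs <;> simp [hM]
        linarith
      simpa [mul_add, Finset.sum_add_distrib, Pi.single_apply] using h
    have h₀ := hM 0 le_rfl
    have h := hM ((∑ j, c j * (g j 0 + 1)) / -c i)
      (div_nonneg (by linarith) (by linarith))
    rw [div_neg, mul_neg, mul_div_cancel₀ _ hi.ne] at h
    linarith
  have hsum : 0 < ∑ i, c i := by
    refine (Finset.sum_nonneg fun i _ => hnonneg i).lt_of_ne' fun h => ?_
    have hc (i : ι) : c i = 0 :=
      (Finset.sum_eq_zero_iff_of_nonneg fun i _ => hnonneg i).1 h i (Finset.mem_univ i)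
    simpa [hc] using hshift 0 1 one_pos
  refine ⟨c, hnonneg, hsum, fun x => le_of_forall_pos_lt_add fun δ hδ => ?_⟩
  simpa [div_mul_cancel₀ δ hsum.ne'] using hshift x (δ / ∑ i, c i) (div_pos hδ hsum)

/-- If `f₁, …, f_N : X → ℝ` are convex and `x₀` is a weak Pareto
Optimum point for `f₁, …, f_N`, then there exists `t ∈ Σ_N` such that
`u_t x₀ ≤ u_t x` for all `x ∈ X`, where `u_t = ∑ tᵢ fᵢ`. -/
theorem scalarization_of_isWeakParetoOptimum
    {X : Type*} [NormedAddCommGroup X] [NormedSpace ℝ X]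
    {N : ℕ} (f : Fin N → X → ℝ) (hconv : ∀ i, ConvexOn ℝ Set.univ (f i))
    (x₀ : X) (hx₀ : IsWeakParetoOptimum f x₀) :
    ∃ t : Fin N → ℝ, (∀ i, t i ∈ Set.Icc (0 : ℝ) 1) ∧ (∑ i, t i) = 1 ∧
      ∀ x : X, ∑ i, t i * f i x₀ ≤ ∑ i, t i * f i x := by
  obtain ⟨c, hc, hsum, hle⟩ := exists_nonneg_weights_of_not_all_neg
    (g := fun i x => f i x - f i x₀)
    (fun i => (hconv i).sub (concaveOn_const _ convex_univ))
    (fun ⟨x, hx⟩ => hx₀ ⟨x, fun k => sub_neg.1 (hx k)⟩)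
  refine ⟨fun i => c i / ∑ j, c j, fun i => ⟨div_nonneg (hc i) hsum.le, ?_⟩, ?_, fun x => ?_⟩
  · exact div_le_one_of_le₀ (Finset.single_le_sum (fun j _ => hc j) (Finset.mem_univ i)) hsum.le
  · rw [← Finset.sum_div, div_self hsum.ne']
  · simp only [div_mul_eq_mul_div, ← Finset.sum_div]
    refine div_le_div_of_nonneg_right ?_ hsum.le
    simpa [mul_sub, Finset.sum_sub_distrib] using hle x
end

section
/- Let X be a reflexive Banach space, let f₁, …, f_N : X → ℝ be U-functions, and let t̂ ∈ Σ_N. If diam(S_α(u_{t̂})) → 0 as α → 0⁺, where S_α(u_{t̂}) = {x ∈ X : u_{t̂}(x) < min(u_{t̂}) + α}, then the map φ : Σ_N → X, φ(t) = argmin(u_t), is continuous at t̂. -/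
open Filter

/-- `f : X → ℝ` is a *U-function*: continuous, strictly convex, bounded on bounded
sets, and coercive (every sublevel set is bounded). -/
def IsUFunction {X : Type*} [NormedAddCommGroup X] [NormedSpace ℝ X]
    (f : X → ℝ) : Prop :=
  Continuous f ∧
  (∀ x y : X, x ≠ y → f ((1 / 2 : ℝ) • (x + y)) < (f x + f y) / 2) ∧
  (∀ s : Set X, Bornology.IsBounded s → Bornology.IsBounded (f '' s)) ∧
  (∀ C : ℝ, Bornology.IsBounded {x : X | f x ≤ C})

/-- The simplex `Σ_N = {t ∈ [0,1]^N : ∑ tᵢ = 1}`. -/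
def Simplex (N : ℕ) : Set (Fin N → ℝ) :=
  {t | (∀ i, t i ∈ Set.Icc (0 : ℝ) 1) ∧ (∑ i, t i) = 1}

/-- The minimizers of all convex combinations of finitely many U-functions lie in a common
set on which each of these functions is bounded. -/
theorem exists_bound_abs_argmin {X : Type*} [NormedAddCommGroup X] [NormedSpace ℝ X]
    {N : ℕ} (f : Fin N → X → ℝ) (hf : ∀ i, IsUFunction (f i)) (φ : (Fin N → ℝ) → X)
    (hφ : ∀ t ∈ Simplex N, ∀ y : X, ∑ i, t i * f i (φ t) ≤ ∑ i, t i * f i y) :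
    ∃ M : Fin N → ℝ, ∀ t ∈ Simplex N, ∀ i, |f i (φ t)| ≤ M i := by
  set B : ℝ := ∑ i, |f i 0| with hB
  set K : Set X := ⋃ i, {x | f i x ≤ B + 1} with hK
  have hKb : Bornology.IsBounded K :=
    Bornology.isBounded_iUnion.2 fun i => (hf i).2.2.2 (B + 1)
  have hM : ∀ i, ∃ M : ℝ, ∀ y ∈ f i '' K, ‖y‖ ≤ M := fun i =>
    isBounded_iff_forall_norm_le.1 ((hf i).2.2.1 K hKb)
  choose M hM using hM
  refine ⟨M, fun t ht i => hM i _ (Set.mem_image_of_mem _ ?_)⟩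
  by_contra hmem
  simp only [hK, Set.mem_iUnion, Set.mem_ofPred_eq, not_exists, not_le] at hmem
  have hlower : B + 1 ≤ ∑ j, t j * f j (φ t) := by
    calc B + 1 = ∑ j, t j * (B + 1) := by rw [← Finset.sum_mul, ht.2, one_mul]
      _ ≤ ∑ j, t j * f j (φ t) := Finset.sum_le_sum fun j _ =>
          mul_le_mul_of_nonneg_left (hmem j).le (ht.1 j).1
  have hupper : ∑ j, t j * f j 0 ≤ B := Finset.sum_le_sum fun j _ =>
    (mul_le_mul_of_nonneg_left (le_abs_self _) (ht.1 j).1).trans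
      (mul_le_of_le_one_left (abs_nonneg _) (ht.1 j).2)
  linarith [hφ t ht 0]

/-- Let `X` be a reflexive Banach space, `f₁, …, f_N`
U-functions, `t̂ ∈ Σ_N`, and let `φ : Σ_N → X` be the argmin map `φ t = argmin u_t`
(here hypothesized via its defining minimality property). If the diameter of the
strict sublevel sets `S_α(u_t̂) = {x : u_t̂ x < min u_t̂ + α}` tends to `0` as
`α → 0⁺`, then `φ` is continuous at `t̂`. -/
theorem argmin_continuousAt_of_smallDiam_sublevels
    {X : Type*} [NormedAddCommGroup X] [NormedSpace ℝ X] [CompleteSpace X]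
    (hrefl : Function.Surjective ⇑(NormedSpace.inclusionInDoubleDual ℝ X))
    {N : ℕ} (f : Fin N → X → ℝ) (hf : ∀ i, IsUFunction (f i))
    (φ : (Fin N → ℝ) → X)
    (hφ : ∀ t ∈ Simplex N, ∀ y : X, ∑ i, t i * f i (φ t) ≤ ∑ i, t i * f i y)
    (that : Fin N → ℝ) (hthat : that ∈ Simplex N)
    (hdiam : Tendsto
      (fun α : ℝ => EMetric.diam
        {x : X | ∑ i, that i * f i x < (∑ i, that i * f i (φ that)) + α})
      (nhdsWithin 0 (Set.Ioi 0)) (nhds 0)) :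
    ContinuousWithinAt φ (Simplex N) that := by
  obtain ⟨M, hM⟩ := exists_bound_abs_argmin f hf φ hφ
  have hclose : ∀ t ∈ Simplex N, ∑ i, that i * f i (φ t) ≤
      (∑ i, that i * f i (φ that)) + ∑ i, |that i - t i| * (2 * M i) := by
    intro t ht
    have hsum : ∑ i, (that i - t i) * (f i (φ t) - f i (φ that)) ≤
        ∑ i, |that i - t i| * (2 * M i) := by
      refine Finset.sum_le_sum fun i _ => (le_abs_self _).trans ?_
      rw [abs_mul]
      refine mul_le_mul_of_nonneg_left ?_ (abs_nonneg _)
      linarith [abs_sub (f i (φ t)) (f i (φ that)), hM t ht i, hM that hthat i]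
    simp only [sub_mul, mul_sub, Finset.sum_sub_distrib] at hsum ⊢
    linarith [hφ t ht (φ that)]
  have hgap : Tendsto (fun t : Fin N → ℝ => ∑ i, |that i - t i| * (2 * M i))
      (nhdsWithin that (Simplex N)) (nhds 0) := by
    have hcont : Continuous fun t : Fin N → ℝ => ∑ i, |that i - t i| * (2 * M i) := by
      fun_prop
    simpa using (hcont.tendsto that).mono_left nhdsWithin_le_nhds
  refine EMetric.tendsto_nhds.2 fun ε hε => ?_
  obtain ⟨α, hαε, hα⟩ := ((hdiam.eventually_lt_const hε).and self_mem_nhdsWithin).exists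
  filter_upwards [hgap.eventually_lt_const hα, self_mem_nhdsWithin] with t htα ht
  refine (Metric.edist_le_ediam_of_mem ?_ ?_).trans_lt hαε
  · exact (hclose t ht).trans_lt (add_lt_add_right htα _)
  · exact lt_add_of_pos_right _ hα
end

section
/- Let X be a reflexive Banach space and let f₁, …, f_N : X → ℝ be U-functions. If f_i has the small diameter property for some i ∈ {1, …, N}, then the map φ : Σ_N → X, φ(t) = argmin(u_t), is continuous at every point of the set {t = (t₁,…,t_N) ∈ Σ_N : t_i ≠ 0}. -/
open Filter

/-- A U-function is strictly midpoint convex and continuous, hence convex. -/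
theorem IsUFunction.convexOn {X : Type*} [NormedAddCommGroup X] [NormedSpace ℝ X]
    {f : X → ℝ} (hf : IsUFunction f) : ConvexOn ℝ Set.univ f := by
  obtain ⟨hc, hs, -, -⟩ := hf
  refine ⟨convex_univ, fun x _ y _ a b ha hb hab => ?_⟩
  by_cases hxy : x = y
  · subst hxy
    rw [← add_smul, ← add_smul, hab, one_smul, one_smul]
  set h : ℝ → ℝ := fun s => f ((1 - s) • x + s • y) - ((1 - s) * f x + s * f y) with h_def
  have h_cont : Continuous h := by fun_prop
  obtain ⟨s, ⟨hs0, hs1⟩, hmax⟩ := isCompact_Icc.exists_isMaxOn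
    (Set.nonempty_Icc.2 (zero_le_one (α := ℝ))) h_cont.continuousOn
  have h_nonpos : h s ≤ 0 := by
    by_contra! hpos
    have hne0 : s ≠ 0 := by
      rintro rfl
      simp [h_def] at hpos
    have hne1 : s ≠ 1 := by
      rintro rfl
      simp [h_def] at hpos
    obtain ⟨d, hd, hd0, hd1⟩ : ∃ d : ℝ, 0 < d ∧ d ≤ s ∧ d ≤ 1 - s :=
      ⟨min s (1 - s), lt_min (lt_of_le_of_ne hs0 (Ne.symm hne0))
        (sub_pos.2 (lt_of_le_of_ne hs1 hne1)), min_le_left _ _, min_le_right _ _⟩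
    have h₁ : h (s - d) ≤ h s := hmax ⟨by linarith, by linarith⟩
    have h₂ : h (s + d) ≤ h s := hmax ⟨by linarith, by linarith⟩
    have hne : (1 - (s - d)) • x + (s - d) • y ≠ (1 - (s + d)) • x + (s + d) • y := by
      intro heq
      have hz : (2 * d) • (x - y) = 0 := by
        rw [← sub_eq_zero] at heq
        rw [← heq]
        module
      rcases smul_eq_zero.1 hz with hz | hz
      · linarith
      · exact hxy (sub_eq_zero.1 hz)
    have hlt := hs _ _ hne
    have hmid : (1 / 2 : ℝ) • ((1 - (s - d)) • x + (s - d) • y +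
        ((1 - (s + d)) • x + (s + d) • y)) = (1 - s) • x + s • y := by module
    rw [hmid] at hlt
    simp only [h_def] at h₁ h₂
    linarith
  have hb' : h b ≤ h s := hmax ⟨hb, by linarith⟩
  have hab' : 1 - b = a := by linarith
  simp only [h_def, hab'] at hb' h_nonpos
  simp only [smul_eq_mul]
  linarith

/-- Fermat's rule for a sum of two convex functions, one of which is continuous. -/
theorem exists_subdiff_of_isMinOn_add {X : Type*} [NormedAddCommGroup X] [NormedSpace ℝ X]
    {F G : X → ℝ} {x : X} (hF : ConvexOn ℝ Set.univ F) (hFc : Continuous F)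
    (hG : ConvexOn ℝ Set.univ G) (hmin : ∀ y, F x + G x ≤ F y + G y) :
    ∃ L : X →L[ℝ] ℝ, Subdiff F x L ∧ Subdiff G x (-L) := by
  have hS : Convex ℝ {p : X × ℝ | F p.1 < p.2} := by
    simpa using hF.convex_strict_epigraph
  have hS' : IsOpen {p : X × ℝ | F p.1 < p.2} :=
    isOpen_lt (hFc.comp continuous_fst) continuous_snd
  have hT : Convex ℝ {p : X × ℝ | p.2 ≤ F x + G x - G p.1} := by
    have hconc : ConcaveOn ℝ Set.univ fun y => F x + G x - G y := by
      exact (concaveOn_const (F x + G x) convex_univ).sub hG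
    simpa using hconc.convex_hypograph
  obtain ⟨ψ, u, hψS, hψT⟩ := geometric_hahn_banach_open hS hS' hT (by
    rw [Set.disjoint_left]
    rintro ⟨y, r⟩ h₁ h₂
    simp only [Set.mem_ofPred_eq] at h₁ h₂
    linarith [hmin y])
  set A : X →L[ℝ] ℝ := ψ.comp (ContinuousLinearMap.inl ℝ X ℝ) with hA
  set c : ℝ := ψ (0, 1) with hc
  have hψ : ∀ y r, ψ (y, r) = A y + r * c := by
    intro y r
    have : ((y, r) : X × ℝ) = (y, 0) + r • (0, 1) := by simp
    rw [this, map_add, map_smul]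
    simp [hA, hc]
  have hSub : ∀ y r, F y < r → A y + r * c < u := fun y r hr => hψ y r ▸ hψS (y, r) hr
  have hTub : ∀ y r, r ≤ F x + G x - G y → u ≤ A y + r * c := fun y r hr => hψ y r ▸ hψT (y, r) hr
  have hFle : ∀ y, A y + F y * c ≤ u := by
    intro y
    have hlim : Tendsto (fun r => A y + r * c) (nhdsWithin (F y) (Set.Ioi (F y)))
        (nhds (A y + F y * c)) :=
      (Continuous.tendsto (by fun_prop) (F y)).mono_left nhdsWithin_le_nhds
    refine le_of_tendsto hlim ?_
    filter_upwards [self_mem_nhdsWithin] with r hr using (hSub y r hr).le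
  have hx : u ≤ A x + F x * c := hTub x (F x) (by linarith)
  have hc_neg : c < 0 := by
    have := hSub x (F x + 1) (by linarith)
    linarith
  refine ⟨(-c)⁻¹ • A, fun y => ?_, fun y => ?_⟩
  · have h₁ := hFle y
    simp only [smul_apply, smul_eq_mul]
    rw [← mul_sub, inv_mul_le_iff₀ (by linarith)]
    linarith
  · have h₁ := hTub y _ le_rfl
    have h₂ := hFle x
    simp only [neg_apply, smul_apply, smul_eq_mul]
    have h₃ : (-c)⁻¹ * (A x - A y) ≤ G y - G x := by
      rw [inv_mul_le_iff₀ (by linarith)]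
      linarith
    linarith

/-- For a U-function with the small diameter property, a sequence along which `L - f` tends to its
maximum value `L x - f x` converges to `x` itself. -/
theorem HasSDP.tendsto {X : Type*} [NormedAddCommGroup X] [NormedSpace ℝ X] {f : X → ℝ}
    (hSDP : HasSDP f) (hf : IsUFunction f) {x : X} {L : X →L[ℝ] ℝ} (hL : Subdiff f x L)
    {u : ℕ → X} (hu : Tendsto (fun n => L (u n) - f (u n)) atTop (nhds (L x - f x))) :
    Tendsto u atTop (nhds x) := by
  obtain ⟨l, hl⟩ := hSDP x L hL u hu
  have hcont : Continuous fun y => L y - f y := L.continuous.sub hf.1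
  have heq : L l - f l = L x - f x := tendsto_nhds_unique ((hcont.tendsto l).comp hl) hu
  by_cases hlx : l = x
  · exact hlx ▸ hl
  · have h₁ := hf.2.1 l x hlx
    have h₂ := hL ((1 / 2 : ℝ) • (l + x))
    rw [map_smul, map_add, smul_eq_mul] at h₂
    linarith

/-- If a convex combination of values is at most the corresponding combination of `b`, then one
of the values is at most `∑ |b j| + 1`. -/
theorem exists_le_of_mem_simplex {N : ℕ} {s a b : Fin N → ℝ} (hs : s ∈ Simplex N)
    (h : ∑ j, s j * a j ≤ ∑ j, s j * b j) : ∃ j, a j ≤ ∑ j, |b j| + 1 := by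
  by_contra! hcon
  have h₁ : ∑ j, s j * (∑ j, |b j| + 1) ≤ ∑ j, s j * a j :=
    Finset.sum_le_sum fun j _ => mul_le_mul_of_nonneg_left (hcon j).le (hs.1 j).1
  rw [← Finset.sum_mul, hs.2, one_mul] at h₁
  have h₂ : ∑ j, s j * b j ≤ ∑ j, |b j| := by
    refine Finset.sum_le_sum fun j _ => ?_
    calc s j * b j ≤ s j * |b j| := mul_le_mul_of_nonneg_left (le_abs_self _) (hs.1 j).1
      _ ≤ |b j| := mul_le_of_le_one_left (abs_nonneg _) (hs.1 j).2
  linarith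

/-- Let `X` be a reflexive Banach space, `f₁, …, f_N`
U-functions, and `φ : Σ_N → X` the argmin map `φ t = argmin u_t` (hypothesized via
its defining minimality property). If `f_i` has the small diameter property for
some `i`, then `φ` is continuous at every point of `{t ∈ Σ_N : tᵢ ≠ 0}`. -/
theorem argmin_continuousOn_of_SDP_single
    {X : Type*} [NormedAddCommGroup X] [NormedSpace ℝ X] [CompleteSpace X]
    (hrefl : Function.Surjective ⇑(NormedSpace.inclusionInDoubleDual ℝ X))
    {N : ℕ} (f : Fin N → X → ℝ) (hf : ∀ i, IsUFunction (f i))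
    (φ : (Fin N → ℝ) → X)
    (hφ : ∀ t ∈ Simplex N, ∀ y : X, ∑ i, t i * f i (φ t) ≤ ∑ i, t i * f i y)
    (i : Fin N) (hSDP : HasSDP (f i)) :
    ∀ t ∈ Simplex N, t i ≠ 0 → ContinuousWithinAt φ (Simplex N) t := by
  intro t ht hti
  have hti_pos : 0 < t i := lt_of_le_of_ne (ht.1 i).1 (Ne.symm hti)
  refine tendsto_of_seq_tendsto fun s hs => ?_
  obtain ⟨hs_lim, hs_mem⟩ := tendsto_nhdsWithin_iff.1 hs
  set x := φ t with hx
  set G : X → ℝ := fun y => ∑ j ∈ Finset.univ.erase i, t j / t i * f j y with hG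
  have hsum : ∀ y, f i y + G y = (∑ j, t j * f j y) / t i := by
    intro y
    rw [← Finset.add_sum_erase _ _ (Finset.mem_univ i), add_div, mul_div_cancel_left₀ _ hti,
      Finset.sum_div]
    simp only [hG, div_mul_eq_mul_div]
  have hGconv : ConvexOn ℝ Set.univ G := by
    have hterm : ∀ j, ConvexOn ℝ Set.univ fun y => t j / t i * f j y := fun j => by
      simpa using (hf j).convexOn.smul (div_nonneg (ht.1 j).1 hti_pos.le)
    refine ⟨convex_univ, fun y _ z _ a b ha hb hab => ?_⟩
    simp only [hG, Finset.smul_sum, ← Finset.sum_add_distrib]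
    exact Finset.sum_le_sum fun j _ => (hterm j).2 trivial trivial ha hb hab
  obtain ⟨L, hLf, hLG⟩ := exists_subdiff_of_isMinOn_add (hf i).convexOn (hf i).1 hGconv
    fun y => by
      rw [hsum, hsum]
      exact div_le_div_of_nonneg_right (hφ t ht y) hti_pos.le
  refine hSDP.tendsto (hf i) hLf ?_
  have hbdd : Bornology.IsBounded (⋃ j, {y | f j y ≤ ∑ j, |f j x| + 1}) :=
    Bornology.isBounded_iUnion.2 fun j => (hf j).2.2.2 _
  have hmem : ∀ᶠ n in atTop, φ (s n) ∈ ⋃ j, {y | f j y ≤ ∑ j, |f j x| + 1} := by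
    filter_upwards [hs_mem] with n hn
    exact Set.mem_iUnion.2 (exists_le_of_mem_simplex hn (hφ (s n) hn x))
  have hzero : Tendsto (fun n => (∑ j, (t j - s n j) * (f j (φ (s n)) - f j x)) / t i)
      atTop (nhds 0) := by
    rw [← zero_div (t i), ← Finset.sum_const_zero (s := (Finset.univ : Finset (Fin N)))]
    refine (tendsto_finsetSum _ fun j _ => ?_).div_const _
    obtain ⟨M, hM⟩ := ((hf j).2.2.1 _ hbdd).exists_norm_le
    have hdiff : Tendsto (fun n => t j - s n j) atTop (nhds 0) := by
      simpa using (tendsto_const_nhds (x := t j)).sub ((tendsto_pi_nhds.1 hs_lim) j)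
    refine hdiff.zero_mul_isBoundedUnder_le (isBoundedUnder_of_eventually_le (a := M + ‖f j x‖) ?_)
    filter_upwards [hmem] with n hn
    exact (norm_sub_le _ _).trans (add_le_add_left (hM _ (Set.mem_image_of_mem _ hn)) _)
  have hlim : Tendsto (fun n => (L x - f i x) - (L (φ (s n)) - f i (φ (s n)))) atTop (nhds 0) := by
    refine squeeze_zero' (Eventually.of_forall fun n => ?_) ?_ hzero
    · linarith [hLf (φ (s n))]
    · filter_upwards [hs_mem] with n hn
      have h₁ := hLG (φ (s n))
      have h₂ := hφ (s n) hn x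
      have h₃ : (∑ j, t j * f j (φ (s n))) / t i - (∑ j, t j * f j x) / t i ≤
          (∑ j, (t j - s n j) * (f j (φ (s n)) - f j x)) / t i := by
        rw [← sub_div]
        refine div_le_div_of_nonneg_right ?_ hti_pos.le
        simp only [sub_mul, mul_sub, Finset.sum_sub_distrib]
        linarith
      rw [← hsum, ← hsum] at h₃
      simp only [neg_apply] at h₁
      linarith
  simpa using (tendsto_const_nhds (x := L x - f i x)).sub hlim
end

section
/- Let X be a reflexive Banach space and let f₁, …, f_N : X → ℝ be U-functions. If f_i has the small diameter property for every i = 1, …, N, then the map φ : Σ_N → X, φ(t) = argmin(u_t), is continuous on all of Σ_N. -/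
open Filter

/-- A continuous midpoint-convex function is convex. -/
theorem convexOn_univ_of_continuous_of_midpoint {X : Type*} [NormedAddCommGroup X]
    [NormedSpace ℝ X] {f : X → ℝ} (hc : Continuous f)
    (hm : ∀ x y : X, f ((1 / 2 : ℝ) • (x + y)) ≤ (f x + f y) / 2) :
    ConvexOn ℝ Set.univ f := by
  refine ⟨convex_univ, fun x _ y _ a b ha hb hab => ?_⟩
  let g : ℝ → ℝ := fun s => f ((1 - s) • x + s • y) - ((1 - s) * f x + s * f y)
  have hg : Continuous g := by fun_prop
  have hgm : ∀ s r, g ((s + r) / 2) ≤ (g s + g r) / 2 := by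
    intro s r
    have h := hm ((1 - s) • x + s • y) ((1 - r) • x + r • y)
    have e : (1 / 2 : ℝ) • ((1 - s) • x + s • y + ((1 - r) • x + r • y))
        = (1 - (s + r) / 2) • x + ((s + r) / 2) • y := by module
    rw [e] at h
    simp only [g]
    linarith
  obtain ⟨m, ⟨hm0, hm1⟩, hmax⟩ := (isCompact_Icc (a := (0 : ℝ)) (b := 1)).exists_isMaxOn
    (Set.nonempty_Icc.2 zero_le_one) hg.continuousOn
  have h0 : g 0 = 0 := by simp [g]
  have h1 : g 1 = 0 := by simp [g]
  have hmle : g m ≤ 0 := by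
    rcases le_total m (1 / 2) with h | h
    · have h2 := hgm 0 (2 * m)
      have h3 : g (2 * m) ≤ g m := hmax ⟨by linarith, by linarith⟩
      rw [show (0 + 2 * m) / 2 = m by ring] at h2
      linarith
    · have h2 := hgm (2 * m - 1) 1
      have h3 : g (2 * m - 1) ≤ g m := hmax ⟨by linarith, by linarith⟩
      rw [show (2 * m - 1 + 1) / 2 = m by ring] at h2
      linarith
  have hb' : g b ≤ g m := hmax ⟨hb, by linarith⟩
  obtain rfl : a = 1 - b := by linarith
  simp only [smul_eq_mul]
  simp only [g] at hb' hmle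
  linarith

/-- At a minimizer of `g + h`, with `g` continuous and both functions convex, some
subgradient of `g` is the opposite of a subgradient of `h`. -/
theorem exists_subdiff_of_forall_add_le {X : Type*} [NormedAddCommGroup X] [NormedSpace ℝ X]
    {g h : X → ℝ} (hgc : Continuous g) (hg : ConvexOn ℝ Set.univ g)
    (hh : ConvexOn ℝ Set.univ h) {x : X} (hx : ∀ y, g x + h x ≤ g y + h y) :
    ∃ xs : X →L[ℝ] ℝ, Subdiff g x xs ∧ Subdiff h x (-xs) := by
  let A : Set (X × ℝ) := {p | p.1 ∈ Set.univ ∧ g p.1 < p.2}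
  let B : Set (X × ℝ) := {p | p.1 ∈ Set.univ ∧ p.2 ≤ g x + h x - h p.1}
  have hA : Convex ℝ A := hg.convex_strict_epigraph
  have hB : Convex ℝ B :=
    ((concaveOn_const (g x + h x) convex_univ).sub hh).convex_hypograph
  have hAo : IsOpen A := by
    have : A = {p : X × ℝ | g p.1 < p.2} := by simp [A]
    rw [this]
    exact isOpen_lt (by fun_prop) (by fun_prop)
  have hAB : Disjoint A B := by
    rw [Set.disjoint_left]
    rintro ⟨y, r⟩ ⟨-, h1⟩ ⟨-, h2⟩
    have := hx y
    simp only at h1 h2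
    linarith
  obtain ⟨F, u, hFA, hFB⟩ := geometric_hahn_banach_open hA hAo hB hAB
  let l : X →L[ℝ] ℝ := F.comp (ContinuousLinearMap.inl ℝ X ℝ)
  let c : ℝ := F (0, 1)
  have hF : ∀ y r, F (y, r) = l y + c * r := by
    intro y r
    have : ((y, r) : X × ℝ) = (y, 0) + r • (0, 1) := by simp
    rw [this, map_add, map_smul]
    simp [l, c, mul_comm]
  have hA' : ∀ y r, g y < r → l y + c * r < u := fun y r hr => by
    rw [← hF]; exact hFA _ ⟨trivial, hr⟩
  have hB' : ∀ y, u ≤ l y + c * (g x + h x - h y) := fun y => by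
    rw [← hF]; exact hFB _ ⟨trivial, le_rfl⟩
  have hBx : u ≤ l x + c * g x := by simpa using hB' x
  have hc : c < 0 := by
    have := hA' x (g x + 1) (by linarith)
    linarith
  have hA'' : ∀ y, l y + c * g y ≤ u := by
    intro y
    refine le_of_forall_pos_lt_add fun ε hε => ?_
    have := hA' y (g y + ε / (-c)) (by have := div_pos hε (neg_pos.2 hc); linarith)
    have e : c * (ε / (-c)) = -ε := by
      have := hc.ne
      field_simp
    rw [mul_add, e] at this
    linarith
  refine ⟨(-c)⁻¹ • l, fun y => ?_, fun y => ?_⟩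
  · have h1 := hA'' y
    have : (-c)⁻¹ * (l y - l x) ≤ g y - g x := by
      rw [inv_mul_le_iff₀ (neg_pos.2 hc)]
      linarith
    simpa [mul_sub] using this
  · have h1 := hB' y
    have h2 := hA'' x
    have : (-c)⁻¹ * (l x - l y) ≤ h y - h x := by
      rw [inv_mul_le_iff₀ (neg_pos.2 hc)]
      linarith
    simp only [neg_apply, smul_apply, smul_eq_mul]
    linarith

section Argmin

variable {X : Type*} [NormedAddCommGroup X] [NormedSpace ℝ X] {N : ℕ} {f : Fin N → X → ℝ}
  {φ : (Fin N → ℝ) → X}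

theorem Simplex.exists_pos {t : Fin N → ℝ} (ht : t ∈ Simplex N) : ∃ i, 0 < t i := by
  by_contra! h
  have := Finset.sum_nonpos fun i (_ : i ∈ Finset.univ) => h i
  linarith [ht.2]

/-- The minimizers of the functions `u_t`, for `t` in the simplex, form a bounded set. -/
theorem isBounded_argmin_image (hf : ∀ i, IsUFunction (f i))
    (hφ : ∀ t ∈ Simplex N, ∀ y : X, ∑ i, t i * f i (φ t) ≤ ∑ i, t i * f i y) :
    Bornology.IsBounded (φ '' Simplex N) := by
  have hb : Bornology.IsBounded (⋃ i, {x | f i x ≤ ∑ j, |f j 0|}) :=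
    Bornology.isBounded_iUnion.2 fun i => (hf i).2.2.2 _
  refine hb.subset ?_
  rintro _ ⟨t, ht, rfl⟩
  by_contra hn
  simp only [Set.mem_iUnion, Set.mem_ofPred_eq, not_exists, not_le] at hn
  obtain ⟨k, hk⟩ := Simplex.exists_pos ht
  have h1 : ∑ i, t i * ∑ j, |f j 0| < ∑ i, t i * f i (φ t) :=
    Finset.sum_lt_sum (fun i _ => mul_le_mul_of_nonneg_left (hn i).le (ht.1 i).1)
      ⟨k, Finset.mem_univ k, mul_lt_mul_of_pos_left (hn k) hk⟩
  have h2 : ∑ i, t i * f i 0 ≤ ∑ i, t i * ∑ j, |f j 0| :=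
    Finset.sum_le_sum fun i _ => mul_le_mul_of_nonneg_left
      ((le_abs_self _).trans (Finset.single_le_sum (f := fun j => |f j 0|)
        (fun j _ => abs_nonneg _) (Finset.mem_univ i))) (ht.1 i).1
  linarith [hφ t ht 0]

/-- As `s → t` in the simplex, the minimizers of `u_s` are minimizing for `u_t`. -/
theorem tendsto_sum_argmin (hf : ∀ i, IsUFunction (f i))
    (hφ : ∀ t ∈ Simplex N, ∀ y : X, ∑ i, t i * f i (φ t) ≤ ∑ i, t i * f i y)
    {t : Fin N → ℝ} (ht : t ∈ Simplex N) :
    Tendsto (fun s => ∑ i, t i * f i (φ s)) (nhdsWithin t (Simplex N))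
      (nhds (∑ i, t i * f i (φ t))) := by
  have hK : ∀ i, ∃ K, ∀ s ∈ Simplex N, |f i (φ s)| ≤ K := fun i => by
    obtain ⟨K, hK⟩ := ((hf i).2.2.1 _ (isBounded_argmin_image hf hφ)).exists_norm_le
    exact ⟨K, fun s hs => hK _ ⟨_, ⟨s, hs, rfl⟩, rfl⟩⟩
  choose K hK using hK
  have hlim : Tendsto (fun s : Fin N → ℝ => ∑ i, s i * f i (φ t) + ∑ i, |t i - s i| * K i)
      (nhdsWithin t (Simplex N)) (nhds (∑ i, t i * f i (φ t))) := by
    have hcont : Continuous fun s : Fin N → ℝ =>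
        ∑ i, s i * f i (φ t) + ∑ i, |t i - s i| * K i := by fun_prop
    simpa using (hcont.tendsto t).mono_left nhdsWithin_le_nhds
  refine tendsto_of_tendsto_of_tendsto_of_le_of_le' tendsto_const_nhds hlim
    (Eventually.of_forall fun s => hφ t ht (φ s)) ?_
  filter_upwards [self_mem_nhdsWithin] with s hs
  have h1 : ∑ i, t i * f i (φ s) - ∑ i, s i * f i (φ s) ≤ ∑ i, |t i - s i| * K i := by
    rw [← Finset.sum_sub_distrib]
    refine Finset.sum_le_sum fun i _ => ?_
    rw [← sub_mul]
    refine (le_abs_self _).trans ?_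
    rw [abs_mul]
    exact mul_le_mul_of_nonneg_left (hK i s hs) (abs_nonneg _)
  linarith [hφ s hs (φ t)]

/-- Every minimizing sequence for `u_t` converges to the minimizer, when each `f i` has the
small diameter property. -/
theorem tendsto_of_tendsto_sum (hf : ∀ i, IsUFunction (f i)) (hSDP : ∀ i, HasSDP (f i))
    {t : Fin N → ℝ} (ht : t ∈ Simplex N) {x : X}
    (hx : ∀ y : X, ∑ i, t i * f i x ≤ ∑ i, t i * f i y) {v : ℕ → X}
    (hv : Tendsto (fun n => ∑ i, t i * f i (v n)) atTop (nhds (∑ i, t i * f i x))) :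
    Tendsto v atTop (nhds x) := by
  obtain ⟨k, hk⟩ := Simplex.exists_pos ht
  let h : X → ℝ := fun y => ∑ i ∈ Finset.univ.erase k, (t k)⁻¹ * t i * f i y
  have hsum : ∀ y, f k y + h y = (t k)⁻¹ * ∑ i, t i * f i y := by
    intro y
    rw [← Finset.add_sum_erase _ _ (Finset.mem_univ k), mul_add, Finset.mul_sum,
      inv_mul_cancel_left₀ hk.ne']
    simp only [h, mul_assoc]
  have hh : ConvexOn ℝ Set.univ h := by
    refine ⟨convex_univ, fun y _ z _ a b ha hb hab => ?_⟩
    simp only [h, smul_eq_mul, Finset.mul_sum]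
    rw [← Finset.sum_add_distrib]
    refine Finset.sum_le_sum fun i _ => ?_
    have h1 := (hf i).convexOn.2 (Set.mem_univ y) (Set.mem_univ z) ha hb hab
    have h2 := mul_le_mul_of_nonneg_left h1 (mul_nonneg (inv_pos.2 hk).le (ht.1 i).1)
    simp only [smul_eq_mul] at h2
    linarith
  obtain ⟨xs, hxs, hxs'⟩ := exists_subdiff_of_forall_add_le (hf k).1 (hf k).convexOn hh
    (x := x) fun y => by
      rw [hsum, hsum]
      exact mul_le_mul_of_nonneg_left (hx y) (inv_pos.2 hk).le
  obtain ⟨l, hl⟩ : ∃ l, Tendsto v atTop (nhds l) := by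
    refine hSDP k x xs hxs v ?_
    have hlow : Tendsto (fun n => xs x - f k x +
        ((f k x + h x) - (f k (v n) + h (v n)))) atTop (nhds (xs x - f k x)) := by
      simp only [hsum]
      simpa using ((hv.const_mul (t k)⁻¹).const_sub
        ((t k)⁻¹ * ∑ i, t i * f i x)).const_add (xs x - f k x)
    refine tendsto_of_tendsto_of_tendsto_of_le_of_le hlow tendsto_const_nhds
      (fun n => ?_) (fun n => ?_)
    · have := hxs' (v n)
      simp only [neg_apply] at this
      simp only
      linarith
    · have := hxs (v n)
      simp only
      linarith
  have hu : Continuous fun y => ∑ i, t i * f i y :=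
    continuous_finsetSum _ fun i _ => continuous_const.mul (hf i).1
  have hlx : ∑ i, t i * f i l = ∑ i, t i * f i x :=
    tendsto_nhds_unique ((hu.tendsto l).comp hl) hv
  rcases eq_or_ne l x with rfl | hne
  · exact hl
  · exfalso
    have h1 : ∑ i, t i * f i ((1 / 2 : ℝ) • (l + x)) < ∑ i, t i * ((f i l + f i x) / 2) :=
      Finset.sum_lt_sum
        (fun i _ => mul_le_mul_of_nonneg_left ((hf i).2.1 l x hne).le (ht.1 i).1)
        ⟨k, Finset.mem_univ k, mul_lt_mul_of_pos_left ((hf k).2.1 l x hne) hk⟩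
    have h2 : ∑ i, t i * ((f i l + f i x) / 2)
        = (∑ i, t i * f i l + ∑ i, t i * f i x) / 2 := by
      rw [← Finset.sum_add_distrib, Finset.sum_div]
      exact Finset.sum_congr rfl fun i _ => by ring
    linarith [hx ((1 / 2 : ℝ) • (l + x))]

end Argmin

/-- Let `X` be a reflexive Banach space, `f₁, …, f_N`
U-functions, and `φ : Σ_N → X` the argmin map `φ t = argmin u_t` (hypothesized via
its defining minimality property). If every `f_i` has the small diameter property,
then `φ` is continuous on all of `Σ_N`. -/
theorem argmin_continuousOn_of_SDP_all
    {X : Type*} [NormedAddCommGroup X] [NormedSpace ℝ X] [CompleteSpace X]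
    (hrefl : Function.Surjective ⇑(NormedSpace.inclusionInDoubleDual ℝ X))
    {N : ℕ} (f : Fin N → X → ℝ) (hf : ∀ i, IsUFunction (f i))
    (φ : (Fin N → ℝ) → X)
    (hφ : ∀ t ∈ Simplex N, ∀ y : X, ∑ i, t i * f i (φ t) ≤ ∑ i, t i * f i y)
    (hSDP : ∀ i, HasSDP (f i)) :
    ContinuousOn φ (Simplex N) := by
  intro t ht
  refine tendsto_of_seq_tendsto fun s hs => ?_
  exact tendsto_of_tendsto_sum hf hSDP ht (hφ t ht) ((tendsto_sum_argmin hf hφ ht).comp hs)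
end

section
/- Let f₁, …, f_N be real-valued continuous functions defined on a convex subset D of a Banach space X, and suppose each f_i is uniformly convex on D. Then there exists a function δ : (0,∞) → (0,∞) such that: (i) for every x, y ∈ D and every i ∈ {1,…,N}, f_i((x+y)/2) ≤ (1/2)(f_i(x) + f_i(y)) − δ(‖x−y‖) (with the convention that this holds trivially when x = y); (ii) the function t ↦ δ(t)/t is strictly increasing on (0,∞); and (iii) lim_{t→0⁺} δ(t)/t = 0. -/
open Filter

/-- Uniform convexity forces the convexity gap to grow at least linearly at distances bounded
below: halving a long segment about its midpoint at most halves the ratio of gap to length. -/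
theorem exists_linear_lower_bound_of_uniform_convexity
    {X : Type*} [NormedAddCommGroup X] [NormedSpace ℝ X] {D : Set X} (hD : Convex ℝ D)
    {f : X → ℝ} {t d : ℝ} (ht : 0 < t) (hd : 0 < d)
    (h : ∀ x ∈ D, ∀ y ∈ D, t ≤ ‖x - y‖ →
      f ((1 / 2 : ℝ) • (x + y)) ≤ (1 / 2) * f x + (1 / 2) * f y - d) :
    ∀ x ∈ D, ∀ y ∈ D, t ≤ ‖x - y‖ →
      d / (2 * t) * ‖x - y‖ ≤ (1 / 2) * (f x + f y) - f ((1 / 2 : ℝ) • (x + y)) := by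
  have hmid : ∀ x ∈ D, ∀ y ∈ D, (1 / 2 : ℝ) • (x + y) ∈ D := by
    intro x hx y hy
    rw [smul_add]
    exact hD hx hy (by norm_num) (by norm_num) (by norm_num)
  have key : ∀ n : ℕ, ∀ x ∈ D, ∀ y ∈ D, t ≤ ‖x - y‖ → ‖x - y‖ ≤ 2 ^ (n + 1) * t →
      d / (2 * t) * ‖x - y‖ ≤ (1 / 2) * (f x + f y) - f ((1 / 2 : ℝ) • (x + y)) := by
    intro n
    induction n with
    | zero =>
      intro x hx y hy h1 h2
      have h3 : d / (2 * t) * ‖x - y‖ ≤ d := by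
        calc d / (2 * t) * ‖x - y‖ ≤ d / (2 * t) * (2 * t) := by
              gcongr
              simpa using h2
          _ = d := by field_simp
      linarith [h x hx y hy h1]
    | succ n ih =>
      intro x hx y hy h1 h2
      rcases le_or_gt ‖x - y‖ (2 ^ (n + 1) * t) with h3 | h3
      · exact ih x hx y hy h1 h3
      have h4 : 2 * t ≤ ‖x - y‖ := by
        refine le_trans ?_ h3.le
        gcongr
        exact le_self_pow₀ one_le_two n.succ_ne_zero
      set m := (1 / 2 : ℝ) • (x + y) with hm
      have hmD : m ∈ D := hmid x hx y hy
      have half : ‖(1 / 2 : ℝ) • (x - y)‖ = ‖x - y‖ / 2 := by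
        rw [norm_smul]
        norm_num
        ring
      have hxm : ‖x - m‖ = ‖x - y‖ / 2 := by
        rw [← half, hm]
        congr 1
        module
      have hym : ‖y - m‖ = ‖x - y‖ / 2 := by
        rw [← half, ← norm_neg, hm]
        congr 1
        module
      have hxy : ‖(1 / 2 : ℝ) • (x + m) - (1 / 2 : ℝ) • (y + m)‖ = ‖x - y‖ / 2 := by
        rw [← half]
        congr 1
        module
      have hmm : (1 / 2 : ℝ) • ((1 / 2 : ℝ) • (x + m) + (1 / 2 : ℝ) • (y + m)) = m := by
        rw [hm]
        module
      have h5 := ih _ (hmid x hx m hmD) _ (hmid y hy m hmD) (by rw [hxy]; linarith)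
        (by rw [hxy]; rw [pow_succ] at h2; linarith)
      rw [hxy, hmm] at h5
      have h6 := h x hx m hmD (by rw [hxm]; linarith)
      have h7 := h y hy m hmD (by rw [hym]; linarith)
      linarith
  intro x hx y hy hxy
  obtain ⟨n, hn⟩ := pow_unbounded_of_one_lt (‖x - y‖ / t) (one_lt_two (α := ℝ))
  refine key n x hx y hy hxy ?_
  rw [div_lt_iff₀ ht] at hn
  refine hn.le.trans ?_
  gcongr
  · norm_num
  · exact n.le_succ

/-- Let `f₁, …, f_N` be continuous real-valued functions on a
convex subset `D` of a Banach space `X`, each uniformly convex on `D`. Then there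
is a common modulus of convexity `δ : (0,∞) → (0,∞)` such that `t ↦ δ t / t` is
strictly increasing on `(0,∞)` and tends to `0` as `t → 0⁺`. -/
theorem common_modulus_of_uniform_convexity
    {X : Type*} [NormedAddCommGroup X] [NormedSpace ℝ X] [CompleteSpace X]
    {N : ℕ} (D : Set X) (hD : Convex ℝ D)
    (f : Fin N → X → ℝ) (hcont : ∀ i, ContinuousOn (f i) D)
    (hUC : ∀ i, ∀ ε > (0 : ℝ), ∃ δ > (0 : ℝ), ∀ x ∈ D, ∀ y ∈ D, ε ≤ ‖x - y‖ →
      f i ((1 / 2 : ℝ) • (x + y)) ≤ (1 / 2) * f i x + (1 / 2) * f i y - δ) :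
    ∃ δ : ℝ → ℝ,
      (∀ s : ℝ, 0 < s → 0 < δ s) ∧
      (∀ i, ∀ x ∈ D, ∀ y ∈ D, x ≠ y →
        f i ((1 / 2 : ℝ) • (x + y)) ≤ (1 / 2) * (f i x + f i y) - δ ‖x - y‖) ∧
      StrictMonoOn (fun s => δ s / s) (Set.Ioi (0 : ℝ)) ∧
      Tendsto (fun s => δ s / s) (nhdsWithin 0 (Set.Ioi 0)) (nhds 0) := by
  let S : ℝ → Set ℝ := fun t => {c | c ≤ 1 ∧ ∀ i, ∀ x ∈ D, ∀ y ∈ D, t ≤ ‖x - y‖ →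
    c * ‖x - y‖ ≤ (1 / 2) * (f i x + f i y) - f i ((1 / 2 : ℝ) • (x + y))}
  have hS : ∀ t > 0, ∃ c ∈ S t, 0 < c := by
    intro t ht
    choose d hd h using fun i => hUC i t ht
    have hev : ∀ᶠ c in nhdsWithin (0 : ℝ) (Set.Ioi 0), ∀ i, c ≤ d i / (2 * t) := by
      refine eventually_all.2 fun i => nhdsWithin_le_nhds (Iic_mem_nhds ?_)
      have := hd i
      positivity
    have hone : ∀ᶠ c in nhdsWithin (0 : ℝ) (Set.Ioi 0), c ≤ 1 :=
      nhdsWithin_le_nhds (Iic_mem_nhds one_pos)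
    obtain ⟨c, ⟨hc, hc1⟩, hc0⟩ := ((hev.and hone).and self_mem_nhdsWithin).exists
    refine ⟨c, ⟨hc1, fun i x hx y hy hxy => ?_⟩, hc0⟩
    exact (mul_le_mul_of_nonneg_right (hc i) (norm_nonneg _)).trans
      (exists_linear_lower_bound_of_uniform_convexity hD ht (hd i) (h i) x hx y hy hxy)
  have hbdd : ∀ t, BddAbove (S t) := fun t => ⟨1, fun c hc => hc.1⟩
  have hpos : ∀ t > 0, 0 < sSup (S t) := fun t ht =>
    let ⟨_, hc, hc0⟩ := hS t ht
    hc0.trans_le (le_csSup (hbdd t) hc)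
  have hle : ∀ t > 0, sSup (S t) ≤ 1 := fun t ht =>
    let ⟨c, hc, _⟩ := hS t ht
    csSup_le ⟨c, hc⟩ fun _ hb => hb.1
  have hmono : ∀ s > 0, ∀ t, s ≤ t → sSup (S s) ≤ sSup (S t) := fun s hs t hst =>
    let ⟨c, hc, _⟩ := hS s hs
    csSup_le_csSup (hbdd t) ⟨c, hc⟩ fun _ hb =>
      ⟨hb.1, fun i x hx y hy hxy => hb.2 i x hx y hy (hst.trans hxy)⟩
  have hdiv : ∀ s > 0, sSup (S s) * (s / (1 + s)) * s / s = sSup (S s) * (s / (1 + s)) :=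
    fun s hs => mul_div_cancel_right₀ _ (ne_of_gt hs)
  refine ⟨fun s => sSup (S s) * (s / (1 + s)) * s, ?_, ?_, ?_, ?_⟩
  · intro s hs
    have := hpos s hs
    positivity
  · intro i x hx y hy hxy
    have hn : 0 < ‖x - y‖ := norm_pos_iff.2 (sub_ne_zero.2 hxy)
    obtain ⟨c, hc, -⟩ := hS _ hn
    have h1 : sSup (S ‖x - y‖) * ‖x - y‖ ≤
        (1 / 2) * (f i x + f i y) - f i ((1 / 2 : ℝ) • (x + y)) := by
      rw [← le_div_iff₀ hn]
      exact csSup_le ⟨c, hc⟩ fun b hb => (le_div_iff₀ hn).2 (hb.2 i x hx y hy le_rfl)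
    have h2 : sSup (S ‖x - y‖) * (‖x - y‖ / (1 + ‖x - y‖)) ≤ sSup (S ‖x - y‖) :=
      mul_le_of_le_one_right (hpos _ hn).le ((div_le_one (by positivity)).2 (by linarith))
    have h3 := mul_le_mul_of_nonneg_right h2 hn.le
    dsimp only
    linarith
  · intro s hs t ht hst
    rw [Set.mem_Ioi] at hs ht
    dsimp only
    rw [hdiv s hs, hdiv t ht]
    refine mul_lt_mul' (hmono s hs t hst.le) ?_ (by positivity) (hpos t ht)
    rw [div_lt_div_iff₀ (by positivity) (by positivity)]
    linarith
  · refine squeeze_zero' (g := fun s => s) ?_ ?_ (tendsto_id.mono_left nhdsWithin_le_nhds)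
    · filter_upwards [self_mem_nhdsWithin] with s hs
      rw [Set.mem_Ioi] at hs
      have := hpos s hs
      positivity
    · filter_upwards [self_mem_nhdsWithin] with s hs
      rw [Set.mem_Ioi] at hs
      rw [hdiv s hs]
      refine (mul_le_of_le_one_left (by positivity) (hle s hs)).trans ?_
      exact div_le_self hs.le (by linarith)
end

section
/- Let X = ℓ₂ and define h₁, h₂ : ℓ₂ → ℝ by h₁(x) = ∑_{n≥2} (x_n − x₁)²/2ⁿ and h₂(x) = ∑_{n≥2} (x_n + x₁ − 1)²/2ⁿ for x = (x₁, x₂, x₃, …) ∈ ℓ₂. Then for every t ∈ (0,1), the function ũ_t = (1−t)h₁ + t h₂ attains no minimum point on ℓ₂, i.e. there is no x ∈ ℓ₂ with ũ_t(x) ≤ ũ_t(y) for all y ∈ ℓ₂. -/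
noncomputable section

/-- `h₁(x) = ∑_{n≥2} (xₙ − x₁)² / 2ⁿ` on `ℓ₂` (here `x : ℕ → ℝ` is indexed from `0`,
so `x₁ = x 0` and, for `n ≥ 2`, `xₙ = x (n-1)`; the summation index `n = k + 2`). -/
def h1 (x : lp (fun _ : ℕ => ℝ) 2) : ℝ :=
  ∑' k : ℕ, ((x : ∀ _ : ℕ, ℝ) (k + 1) - (x : ∀ _ : ℕ, ℝ) 0) ^ 2 / 2 ^ (k + 2)

/-- `h₂(x) = ∑_{n≥2} (xₙ + x₁ − 1)² / 2ⁿ` on `ℓ₂`. -/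
def h2 (x : lp (fun _ : ℕ => ℝ) 2) : ℝ :=
  ∑' k : ℕ, ((x : ∀ _ : ℕ, ℝ) (k + 1) + (x : ∀ _ : ℕ, ℝ) 0 - 1) ^ 2 / 2 ^ (k + 2)

theorem lp_two_abs_apply_le_norm (x : lp (fun _ : ℕ => ℝ) 2) (k : ℕ) :
    |(x : ∀ _ : ℕ, ℝ) k| ≤ ‖x‖ := by
  simpa using lp.norm_apply_le_norm (by norm_num) x k

theorem summable_sq_add_const_div_two_pow (x : lp (fun _ : ℕ => ℝ) 2) (c : ℝ) :
    Summable fun k : ℕ => ((x : ∀ _ : ℕ, ℝ) (k + 1) + c) ^ 2 / 2 ^ (k + 2) := by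
  refine Summable.of_nonneg_of_le (fun k => by positivity) (fun k => ?_)
    (summable_geometric_two.mul_left ((‖x‖ + |c|) ^ 2))
  have hsq : ((x : ∀ _ : ℕ, ℝ) (k + 1) + c) ^ 2 ≤ (‖x‖ + |c|) ^ 2 := by
    refine sq_le_sq' ?_ ?_ <;>
      linarith [abs_le.1 (lp_two_abs_apply_le_norm x (k + 1)), abs_le.1 (le_refl |c|)]
  rw [one_div, inv_pow, ← div_eq_mul_inv]
  gcongr
  · norm_num
  · omega

theorem h1_nonneg (x : lp (fun _ : ℕ => ℝ) 2) : 0 ≤ h1 x :=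
  tsum_nonneg fun k => by positivity

theorem h2_nonneg (x : lp (fun _ : ℕ => ℝ) 2) : 0 ≤ h2 x :=
  tsum_nonneg fun k => by positivity

theorem eq_neg_of_tsum_sq_add_const_eq_zero (x : lp (fun _ : ℕ => ℝ) 2) (c : ℝ)
    (h : ∑' k : ℕ, ((x : ∀ _ : ℕ, ℝ) (k + 1) + c) ^ 2 / 2 ^ (k + 2) = 0) (k : ℕ) :
    (x : ∀ _ : ℕ, ℝ) (k + 1) = -c := by
  have hs := (summable_sq_add_const_div_two_pow x c).hasSum
  rw [h, hasSum_zero_iff_of_nonneg (fun k => by positivity)] at hs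
  have hk := congrFun hs k
  have hp : (2 : ℝ) ^ (k + 2) ≠ 0 := by positivity
  simp only [Pi.zero_apply, div_eq_zero_iff, hp, or_false] at hk
  linarith [pow_eq_zero_iff (two_ne_zero) |>.1 hk]

theorem apply_eq_of_h1_eq_zero {x : lp (fun _ : ℕ => ℝ) 2} (h : h1 x = 0) (k : ℕ) :
    (x : ∀ _ : ℕ, ℝ) (k + 1) = (x : ∀ _ : ℕ, ℝ) 0 := by
  simpa using eq_neg_of_tsum_sq_add_const_eq_zero x (-(x : ∀ _ : ℕ, ℝ) 0)
    (by simpa only [h1, sub_eq_add_neg] using h) k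

theorem apply_eq_of_h2_eq_zero {x : lp (fun _ : ℕ => ℝ) 2} (h : h2 x = 0) (k : ℕ) :
    (x : ∀ _ : ℕ, ℝ) (k + 1) = 1 - (x : ∀ _ : ℕ, ℝ) 0 := by
  simpa using eq_neg_of_tsum_sq_add_const_eq_zero x ((x : ∀ _ : ℕ, ℝ) 0 - 1)
    (by simpa only [h2, add_sub_assoc] using h) k

theorem lp_two_tendsto_zero (x : lp (fun _ : ℕ => ℝ) 2) :
    Filter.Tendsto (x : ∀ _ : ℕ, ℝ) Filter.atTop (nhds 0) := by
  have h := ((lp.memℓp x).summable (by norm_num)).tendsto_atTop_zero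
  have h2 : Filter.Tendsto (fun k => ((x : ∀ _ : ℕ, ℝ) k) ^ 2) Filter.atTop (nhds 0) := by
    simpa using h
  have h3 := h2.sqrt
  simp only [Real.sqrt_sq_eq_abs, Real.sqrt_zero] at h3
  exact (tendsto_zero_iff_abs_tendsto_zero _).2 h3

theorem not_h1_eq_zero_and_h2_eq_zero (x : lp (fun _ : ℕ => ℝ) 2) :
    ¬ (h1 x = 0 ∧ h2 x = 0) := by
  rintro ⟨hx1, hx2⟩
  have h0 : (x : ∀ _ : ℕ, ℝ) 0 = 1 / 2 := by
    linarith [apply_eq_of_h1_eq_zero hx1 0, apply_eq_of_h2_eq_zero hx2 0]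
  have hlim := (Filter.tendsto_add_atTop_iff_nat 1).2 (lp_two_tendsto_zero x)
  simp only [apply_eq_of_h1_eq_zero hx1, h0] at hlim
  exact absurd (tendsto_nhds_unique tendsto_const_nhds hlim) (by norm_num)

/-- The sequence equal to `1 / 2` at the indices `0, …, N` and to `0` afterwards. -/
def truncatedHalf (N : ℕ) : lp (fun _ : ℕ => ℝ) 2 :=
  ⟨fun k => if k ≤ N then 1 / 2 else 0, by
    refine (memℓp_zero ?_).of_exponent_ge zero_le
    refine (Set.finite_Iic N).subset fun k hk => ?_
    by_contra hkN
    exact hk (if_neg hkN)⟩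

theorem truncatedHalf_apply (N k : ℕ) :
    (truncatedHalf N : ∀ _ : ℕ, ℝ) k = if k ≤ N then 1 / 2 else 0 := rfl

theorem h2_truncatedHalf (N : ℕ) : h2 (truncatedHalf N) = h1 (truncatedHalf N) := by
  simp only [h1, h2, truncatedHalf_apply, Nat.zero_le, if_true]
  congr! 3 with k
  ring

theorem tendsto_h1_truncatedHalf :
    Filter.Tendsto (fun N => h1 (truncatedHalf N)) Filter.atTop (nhds 0) := by
  rw [← tsum_zero (α := ℝ) (β := ℕ)]
  refine tendsto_tsum_of_dominated_convergence summable_geometric_two (fun k => ?_)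
    (Filter.Eventually.of_forall fun N k => ?_)
  · refine tendsto_const_nhds.congr' ?_
    filter_upwards [Filter.eventually_ge_atTop (k + 1)] with N hN
    simp [truncatedHalf_apply, hN]
  · have hsq : ((truncatedHalf N : ∀ _ : ℕ, ℝ) (k + 1) -
        (truncatedHalf N : ∀ _ : ℕ, ℝ) 0) ^ 2 ≤ 1 := by
      simp only [truncatedHalf_apply, Nat.zero_le, if_true]
      split_ifs <;> norm_num
    rw [Real.norm_of_nonneg (by positivity), one_div, inv_pow, ← one_div]
    gcongr
    · norm_num
    · omega

/-- For every `t ∈ (0,1)`, the function `ũ_t = (1−t) h₁ + t h₂`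
attains no minimum point on `ℓ₂`. -/
theorem no_min_of_convex_combination
    (t : ℝ) (ht : t ∈ Set.Ioo (0 : ℝ) 1) :
    ¬ ∃ x : lp (fun _ : ℕ => ℝ) 2, ∀ y : lp (fun _ : ℕ => ℝ) 2,
      (1 - t) * h1 x + t * h2 x ≤ (1 - t) * h1 y + t * h2 y := by
  rintro ⟨x, hx⟩
  obtain ⟨ht0, ht1⟩ := ht
  have hle : (1 - t) * h1 x + t * h2 x ≤ 0 := by
    refine ge_of_tendsto' tendsto_h1_truncatedHalf fun N => (hx (truncatedHalf N)).trans_eq ?_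
    rw [h2_truncatedHalf]
    ring
  have hx1 := h1_nonneg x
  have hx2 := h2_nonneg x
  refine not_h1_eq_zero_and_h2_eq_zero x ⟨?_, ?_⟩ <;> nlinarith

end
end
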